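/- arXiv:2401.04946 — 2 statements merged into one kernel-verified Lean document; each statement's English description precedes it below -/
import Mathlib

section
/- For real 0 < α ≤ 1 and given a bilinear pairing ⟨·,·⟩ (inner product on L²(Ω)), for functions v, w and any t > 0: I(⟨I^{1−α}v, w⟩)(t) ≤ (1/α)·(I(⟨I^{1−α}v, v⟩)(t))^{1/2} · (I(⟨I^{1−α}w, w⟩)(t))^{1/2}, where I denotes the time integral from 0 to t and I^{1−α} is the Riemann–Liouville fractional integral of order 1−α. -/
open MeasureTheory RealInnerProductSpace

/-- Riemann–Liouville fractional integral of order `β` of an `H`-valued function. -/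
noncomputable def fracInt {H : Type*} [NormedAddCommGroup H] [NormedSpace ℝ H]
    (β : ℝ) (v : ℝ → H) (t : ℝ) : H :=
  ∫ s in (0:ℝ)..t, ((t - s) ^ (β - 1) / Real.Gamma β) • v s

open Set in
lemma gam_int {a r : ℝ} (ha : 0 < a) (hr : 0 < r) :
    IntegrableOn (fun t : ℝ => t ^ (a - 1) * Real.exp (-(r * t))) (Ioi 0) := by
  by_contra h
  have h1 := Real.integral_rpow_mul_exp_neg_mul_Ioi ha hr
  rw [integral_undef h] at h1
  have := Real.Gamma_pos_of_pos ha
  have : 0 < (1 / r) ^ a * Real.Gamma a := by positivity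
  linarith

open Set in
lemma betaInf {a d : ℝ} (ha : 0 < a) (ha2 : a < 1 / 2) (hd : 0 < d) :
    IntegrableOn (fun y : ℝ => y ^ (a - 1) * (y + d) ^ (a - 1)) (Ioi 0) ∧
    ∫ y in Ioi (0:ℝ), y ^ (a - 1) * (y + d) ^ (a - 1) =
      Real.Gamma a * Real.Gamma (1 - 2 * a) / Real.Gamma (1 - a) * d ^ (2 * a - 1) := by
  set ν : Measure ℝ := volume.restrict (Ioi 0) with hν
  let f : ℝ × ℝ → ℝ := fun p =>
    (p.1 ^ (a - 1) * Real.exp (-(p.2 * p.1))) * (p.2 ^ (-a) * Real.exp (-(d * p.2)))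
  have hfm : Measurable f := by fun_prop
  have hpos : ∀ᵐ z ∂ν, 0 < z := ae_restrict_mem measurableSet_Ioi
  have hin : ∀ z : ℝ, 0 < z → ∫ y, f (y, z) ∂ν =
      Real.Gamma a * (z ^ ((1 - 2 * a) - 1) * Real.exp (-(d * z))) := by
    intro z hz
    simp only [f]
    rw [integral_mul_const, Real.integral_rpow_mul_exp_neg_mul_Ioi ha hz]
    rw [one_div, Real.inv_rpow hz.le, ← Real.rpow_neg hz.le,
      show (1 - 2 * a) - 1 = -a + -a by ring, Real.rpow_add hz]
    ring
  have hnn : ∀ y z : ℝ, 0 < y → 0 < z → 0 ≤ f (y, z) := by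
    intro y z hy hz
    simp only [f]
    positivity
  have hI := gam_int (a := 1 - 2 * a) (by linarith) hd
  have hfint : Integrable f (ν.prod ν) := by
    rw [integrable_prod_iff' hfm.aestronglyMeasurable]
    constructor
    · filter_upwards [hpos] with z hz
      exact Integrable.mul_const (gam_int ha hz) (z ^ (-a) * Real.exp (-(d * z)))
    · refine (hI.const_mul (Real.Gamma a)).congr ?_
      filter_upwards [hpos] with z hz
      rw [← hin z hz]
      apply integral_congr_ae
      filter_upwards [hpos] with y hy
      rw [Real.norm_of_nonneg (hnn y z hy hz)]
  have hG1 : 0 < Real.Gamma (1 - a) := Real.Gamma_pos_of_pos (by linarith)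
  have hout : ∀ y : ℝ, 0 < y → ∫ z, f (y, z) ∂ν =
      Real.Gamma (1 - a) * (y ^ (a - 1) * (y + d) ^ (a - 1)) := by
    intro y hy
    have : ∀ z, f (y, z) = y ^ (a - 1) * (z ^ ((1 - a) - 1) * Real.exp (-((y + d) * z))) := by
      intro z
      simp only [f]
      rw [show -((y + d) * z) = -(z * y) + -(d * z) by ring, Real.exp_add,
        show (1 - a) - 1 = -a by ring]
      ring
    simp_rw [this]
    rw [integral_const_mul, Real.integral_rpow_mul_exp_neg_mul_Ioi (by linarith) (by linarith),
      one_div, Real.inv_rpow (by linarith), ← Real.rpow_neg (by linarith),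
      show -(1 - a) = a - 1 by ring]
    ring
  constructor
  · have h := (hfint.integral_prod_left).const_mul (Real.Gamma (1 - a))⁻¹
    refine h.congr ?_
    filter_upwards [hpos] with y hy
    rw [hout y hy]
    field_simp
  · have h := integral_integral_swap (f := fun y z => f (y, z)) hfint
    rw [integral_congr_ae (hpos.mono hout), integral_congr_ae (hpos.mono hin),
      integral_const_mul, integral_const_mul,
      Real.integral_rpow_mul_exp_neg_mul_Ioi (by linarith) hd,
      one_div, Real.inv_rpow hd.le, ← Real.rpow_neg hd.le,
      show -(1 - 2 * a) = 2 * a - 1 by ring] at h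
    rw [div_mul_eq_mul_div, eq_div_iff hG1.ne']
    linarith

open Set in
lemma betaFin {a d : ℝ} (ha : 0 < a) (hd : 0 < d) :
    IntegrableOn (fun y : ℝ => y ^ (a - 1) * (d - y) ^ (a - 1)) (Ioc 0 d) ∧
    ∫ y in Ioc (0:ℝ) d, y ^ (a - 1) * (d - y) ^ (a - 1) =
      Real.Gamma a * Real.Gamma a / Real.Gamma (2 * a) * d ^ (2 * a - 1) := by
  have hG := Real.Gamma_pos_of_pos ha
  have hG2 : 0 < Real.Gamma (2 * a) := Real.Gamma_pos_of_pos (by linarith)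
  have key : ∫ y in Ioc (0:ℝ) d, y ^ (a - 1) * (d - y) ^ (a - 1) =
      Real.Gamma a * Real.Gamma a / Real.Gamma (2 * a) * d ^ (2 * a - 1) := by
    have h1 := Complex.betaIntegral_scaled (a : ℂ) (a : ℂ) hd
    have h2 := Complex.Gamma_mul_Gamma_eq_betaIntegral (s := (a : ℂ)) (t := (a : ℂ))
      (by simpa) (by simpa)
    rw [← Complex.ofReal_add, Complex.Gamma_ofReal, Complex.Gamma_ofReal, ← two_mul] at h2
    have h3 : Complex.betaIntegral a a =
        ((Real.Gamma a * Real.Gamma a / Real.Gamma (2 * a) : ℝ) : ℂ) := by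
      push_cast
      rw [h2]
      have : (Real.Gamma (2 * a) : ℂ) ≠ 0 := by exact_mod_cast hG2.ne'
      field_simp
    rw [h3, intervalIntegral.integral_of_le hd.le] at h1
    rw [← Complex.ofReal_inj, ← integral_complex_ofReal]
    rw [Complex.ofReal_mul _ (d ^ _), Complex.ofReal_cpow hd.le, mul_comm (Complex.ofReal _)]
    convert! h1 using 1
    · apply setIntegral_congr_fun measurableSet_Ioc
      intro y hy
      simp only
      rw [Complex.ofReal_mul, Complex.ofReal_cpow hy.1.le, Complex.ofReal_cpow (by linarith [hy.2])]
      push_cast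
      rfl
    · push_cast
      ring_nf
  refine ⟨?_, key⟩
  by_contra h
  rw [integral_undef h] at key
  have : 0 < Real.Gamma a * Real.Gamma a / Real.Gamma (2 * a) * d ^ (2 * a - 1) := by positivity
  linarith

lemma gam_const {a : ℝ} (ha : 0 < a) (ha2 : a < 1 / 2) :
    2 * (Real.Gamma a * Real.Gamma (1 - 2 * a) / Real.Gamma (1 - a)) * (1 - 2 * a) ≤
      Real.Gamma a * Real.Gamma a / Real.Gamma (2 * a) := by
  have hG := Real.Gamma_pos_of_pos ha
  have hG2 : 0 < Real.Gamma (2 * a) := Real.Gamma_pos_of_pos (by linarith)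
  have hG3 : 0 < Real.Gamma (1 - a) := Real.Gamma_pos_of_pos (by linarith)
  have hG4 : 0 < Real.Gamma (1 - 2 * a) := Real.Gamma_pos_of_pos (by linarith)
  have e1 := Real.Gamma_mul_Gamma_one_sub a
  have e2 := Real.Gamma_mul_Gamma_one_sub (2 * a)
  have hpi := Real.pi_pos
  have hs : 0 < Real.sin (Real.pi * a) := Real.sin_pos_of_pos_of_lt_pi (by positivity) (by nlinarith)
  have hc : 1 - 2 * a ≤ Real.cos (Real.pi * a) := by
    have := Real.one_sub_mul_le_cos (x := Real.pi * a) (by positivity) (by nlinarith)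
    convert this using 1
    field_simp
  have hc0 : 0 < Real.cos (Real.pi * a) := by linarith
  rw [show Real.pi * (2 * a) = 2 * (Real.pi * a) by ring, Real.sin_two_mul] at e2
  have e3 : Real.Gamma a * Real.Gamma (1 - a) =
      2 * Real.cos (Real.pi * a) * (Real.Gamma (2 * a) * Real.Gamma (1 - 2 * a)) := by
    rw [e1, e2]; field_simp
  rw [le_div_iff₀ hG2]
  rw [show 2 * (Real.Gamma a * Real.Gamma (1 - 2 * a) / Real.Gamma (1 - a)) * (1 - 2 * a) * Real.Gamma (2 * a)
    = (2 * (1 - 2 * a) * (Real.Gamma (2 * a) * Real.Gamma (1 - 2 * a))) * Real.Gamma a / Real.Gamma (1 - a) by ring,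
    div_le_iff₀ hG3]
  have : 2 * (1 - 2 * a) * (Real.Gamma (2 * a) * Real.Gamma (1 - 2 * a)) ≤ Real.Gamma a * Real.Gamma (1 - a) := by
    rw [e3]; gcongr
  nlinarith

open Set in
lemma fubK {H : Type*} [NormedAddCommGroup H] [InnerProductSpace ℝ H] [CompleteSpace H]
    (t : ℝ) (v w : ℝ → H) (hv : Continuous v) (hw : Continuous w)
    (K1 K2 : ℝ → ℝ → ℝ) (m1 : Measurable (Function.uncurry K1)) (m2 : Measurable (Function.uncurry K2))
    (n1 : ∀ x r, 0 ≤ K1 x r) (n2 : ∀ x r, 0 ≤ K2 x r)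
    (i1 : ∀ x, IntegrableOn (fun r => K1 x r • v r) (Ioc 0 t))
    (i2 : ∀ x, IntegrableOn (fun r => K2 x r • w r) (Ioc 0 t))
    (M : ℝ × ℝ → ℝ)
    (hM : Integrable M ((volume.restrict (Ioc 0 t)).prod (volume.restrict (Ioc 0 t))))
    (hK : ∀ᵐ p ∂((volume.restrict (Ioc 0 t)).prod (volume.restrict (Ioc 0 t))),
      Integrable (fun x => K1 x p.1 * K2 x p.2) ∧ ∫ x, K1 x p.1 * K2 x p.2 = M p) :
    Integrable (fun x => ⟪∫ r in Ioc 0 t, K1 x r • v r, ∫ r in Ioc 0 t, K2 x r • w r⟫) ∧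
    ∫ x, ⟪∫ r in Ioc 0 t, K1 x r • v r, ∫ r in Ioc 0 t, K2 x r • w r⟫ =
      ∫ p, M p * ⟪v p.1, w p.2⟫ ∂((volume.restrict (Ioc 0 t)).prod (volume.restrict (Ioc 0 t))) := by
  set μ : Measure ℝ := volume.restrict (Ioc 0 t) with hμ
  let G : ℝ × (ℝ × ℝ) → ℝ := fun q => K1 q.1 q.2.1 * K2 q.1 q.2.2
  have hGm : Measurable G := by
    have e1 : Measurable (fun q : ℝ × (ℝ × ℝ) => K1 q.1 q.2.1) :=
      m1.comp (measurable_fst.prodMk (measurable_fst.comp measurable_snd))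
    have e2 : Measurable (fun q : ℝ × (ℝ × ℝ) => K2 q.1 q.2.2) :=
      m2.comp (measurable_fst.prodMk (measurable_snd.comp measurable_snd))
    exact e1.mul e2
  have hGi : Integrable G ((volume : Measure ℝ).prod (μ.prod μ)) := by
    rw [integrable_prod_iff' hGm.aestronglyMeasurable]
    refine ⟨hK.mono fun p hp => hp.1, hM.congr ?_⟩
    filter_upwards [hK] with p hp
    rw [← hp.2]
    congr 1
    ext x
    rw [Real.norm_of_nonneg (mul_nonneg (n1 _ _) (n2 _ _))]
  obtain ⟨C, hC⟩ : ∃ C, ∀ p ∈ (Icc 0 t ×ˢ Icc 0 t : Set (ℝ × ℝ)), ‖⟪v p.1, w p.2⟫‖ ≤ C :=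
    (isCompact_Icc.prod isCompact_Icc).exists_bound_of_continuousOn
      (f := fun p : ℝ × ℝ => ⟪v p.1, w p.2⟫) (by fun_prop)
  have hμμ : ∀ᵐ p ∂(μ.prod μ), p ∈ (Icc 0 t ×ˢ Icc 0 t : Set (ℝ × ℝ)) := by
    rw [hμ, Measure.prod_restrict]
    filter_upwards [ae_restrict_mem (measurableSet_Ioc.prod measurableSet_Ioc)] with p hp
    exact ⟨Ioc_subset_Icc_self hp.1, Ioc_subset_Icc_self hp.2⟩
  have hFi : Integrable (fun q : ℝ × (ℝ × ℝ) => G q * ⟪v q.2.1, w q.2.2⟫)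
      ((volume : Measure ℝ).prod (μ.prod μ)) := by
    refine hGi.mul_bdd (c := C) ?_ ?_
    · have : Continuous (fun q : ℝ × (ℝ × ℝ) => ⟪v q.2.1, w q.2.2⟫) := by fun_prop
      exact this.aestronglyMeasurable
    · have := Measure.quasiMeasurePreserving_snd (μ := (volume : Measure ℝ)) (ν := μ.prod μ)
      filter_upwards [this.ae hμμ] with q hq
      exact hC _ hq
  have hae : ∀ᵐ x, ∫ p, G (x, p) * ⟪v p.1, w p.2⟫ ∂(μ.prod μ) =
      ⟪∫ r, K1 x r • v r ∂μ, ∫ r, K2 x r • w r ∂μ⟫ := by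
    filter_upwards [hFi.prod_right_ae] with x hx
    rw [integral_prod _ hx]
    have : ∀ r, ∫ s, G (x, (r, s)) * ⟪v r, w s⟫ ∂μ =
        ⟪∫ s, K2 x s • w s ∂μ, K1 x r • v r⟫ := by
      intro r
      rw [real_inner_comm, ← integral_inner (i2 x)]
      congr 1
      ext s
      simp only [G, real_inner_smul_left, real_inner_smul_right]
      ring
    simp only [this]
    rw [integral_inner (i1 x), real_inner_comm]
  refine ⟨hFi.integral_prod_left.congr hae, ?_⟩
  rw [← integral_congr_ae hae]
  have := integral_integral_swap (f := fun x p => G (x, p) * ⟪v p.1, w p.2⟫) hFi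
  rw [this]
  apply integral_congr_ae
  filter_upwards [hK] with p hp
  rw [integral_mul_const, ← hp.2]

/-- truncated power -/
noncomputable def gpow (c x : ℝ) : ℝ := if 0 < x then x ^ c else 0

lemma gpow_nonneg (c x : ℝ) : 0 ≤ gpow c x := by
  unfold gpow; split_ifs <;> positivity

lemma gpow_meas (c : ℝ) : Measurable (gpow c) := by
  unfold gpow
  exact Measurable.ite measurableSet_Ioi (by fun_prop) measurable_const

lemma gpow_eq (c : ℝ) : gpow c = (Set.Ioi (0:ℝ)).indicator (fun x => x ^ c) := by
  ext x; simp [gpow, Set.indicator]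

open Set in
lemma gpow_locInt {c : ℝ} (hc : -1 < c) : LocallyIntegrable (gpow c) := by
  have h : LocallyIntegrable (fun x : ℝ => x ^ c) := by
    rw [locallyIntegrable_iff]
    intro k hk
    obtain ⟨B, hB⟩ := hk.isBounded.subset_closedBall 0
    have := (intervalIntegral.intervalIntegrable_rpow' (a := -|B| - 1) (b := |B|) hc)
    rw [intervalIntegrable_iff_integrableOn_Ioc_of_le (by linarith [abs_nonneg B])] at this
    refine this.mono_set fun x hx => ?_
    have h1 := hB hx
    rw [Metric.mem_closedBall, dist_zero_right, Real.norm_eq_abs, abs_le] at h1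
    constructor <;> linarith [le_abs_self B]
  rw [gpow_eq, locallyIntegrable_iff]
  intro k hk
  exact ((locallyIntegrable_iff.1 h) k hk).indicator measurableSet_Ioi

open Set in
lemma gpow_int_right {H : Type*} [NormedAddCommGroup H] [NormedSpace ℝ H] {c : ℝ} (hc : -1 < c)
    (v : ℝ → H) (hv : Continuous v) (t x : ℝ) :
    IntegrableOn (fun r => gpow c (x - r) • v r) (Ioc 0 t) := by
  have h : IntegrableOn (fun r => gpow c (x - r)) (Icc 0 t) := by
    have h1 := (locallyIntegrable_iff.1 (gpow_locInt hc)) _ (isCompact_Icc (a := x - t) (b := x - 0))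
    have := (Measure.measurePreserving_sub_left volume x).integrableOn_comp_preimage
      (measurableEmbedding_subLeft x) (f := gpow c) (s := Icc (x - t) (x - 0))
    rw [← this] at h1
    simpa [Function.comp_def] using h1
  exact (h.smul_continuousOn hv.continuousOn isCompact_Icc).mono_set Ioc_subset_Icc_self

open Set in
lemma gpow_int_left {H : Type*} [NormedAddCommGroup H] [NormedSpace ℝ H] {c : ℝ} (hc : -1 < c)
    (v : ℝ → H) (hv : Continuous v) (t x : ℝ) :
    IntegrableOn (fun r => gpow c (r - x) • v r) (Ioc 0 t) := by
  have h : IntegrableOn (fun r => gpow c (r - x)) (Icc 0 t) := by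
    have h1 := (locallyIntegrable_iff.1 (gpow_locInt hc)) _ (isCompact_Icc (a := 0 - x) (b := t - x))
    have := (measurePreserving_sub_right volume x).integrableOn_comp_preimage
      (measurableEmbedding_subRight x) (f := gpow c) (s := Icc (0 - x) (t - x))
    rw [← this] at h1
    simpa [Function.comp_def] using h1
  exact (h.smul_continuousOn hv.continuousOn isCompact_Icc).mono_set Ioc_subset_Icc_self

open Set in
lemma gpow_int2 {c : ℝ} (hc : -1 < c) (t : ℝ) :
    Integrable (fun p : ℝ × ℝ => gpow c (p.2 - p.1))
      ((volume.restrict (Ioc 0 t)).prod (volume.restrict (Ioc 0 t))) := by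
  have h1 : Integrable ((Icc (-t) t).indicator (gpow c)) :=
    ((locallyIntegrable_iff.1 (gpow_locInt hc)) _ isCompact_Icc).integrable_indicator measurableSet_Icc
  have h2 : Integrable (fun _ : ℝ => (1:ℝ)) (volume.restrict (Ioc 0 t)) := integrable_const _
  have h3 := (h2.convolution_integrand (ContinuousLinearMap.mul ℝ ℝ) h1).swap
  have h4 := h3.mono_measure (μ := ((volume.restrict (Ioc 0 t)).prod (volume.restrict (Ioc 0 t)))) ?_
  · refine h4.congr ?_
    rw [Measure.prod_restrict]
    filter_upwards [ae_restrict_mem (measurableSet_Ioc.prod measurableSet_Ioc)] with p hp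
    have : p.2 - p.1 ∈ Icc (-t) t := by
      have h1 := hp.1.1; have h2 := hp.1.2; have h3 := hp.2.1; have h4 := hp.2.2
      constructor <;> linarith
    simp [indicator_of_mem this]
  · exact Measure.prod_mono le_rfl Measure.restrict_le_self

lemma gpow_PP_lt {a r s : ℝ} (ha : 0 < a) (ha2 : a < 1 / 2) (hrs : r < s) :
    Integrable (fun x => gpow (a - 1) (x - r) * gpow (a - 1) (x - s)) ∧
    ∫ x, gpow (a - 1) (x - r) * gpow (a - 1) (x - s) =
      Real.Gamma a * Real.Gamma (1 - 2 * a) / Real.Gamma (1 - a) *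
        (gpow (2 * a - 1) (s - r) + gpow (2 * a - 1) (r - s)) := by
  have hd : 0 < s - r := by linarith
  obtain ⟨h1, h2⟩ := betaInf ha ha2 hd
  have e : (fun x => gpow (a - 1) (x - r) * gpow (a - 1) (x - s)) = fun x =>
      (Set.Ioi (0:ℝ)).indicator (fun y : ℝ => y ^ (a - 1) * (y + (s - r)) ^ (a - 1)) (x - s) := by
    ext x
    by_cases h : 0 < x - s
    · have h' : 0 < x - r := by linarith
      rw [Set.indicator_of_mem (by exact h)]
      simp only [gpow, h, h', if_true]
      rw [show x - s + (s - r) = x - r by ring]; ring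
    · rw [Set.indicator_of_notMem (by exact h)]
      simp [gpow, h]
  rw [e]
  constructor
  · exact (h1.integrable_indicator measurableSet_Ioi).comp_sub_right s
  · rw [integral_sub_right_eq_self, integral_indicator measurableSet_Ioi, h2]
    have : ¬ 0 < r - s := by linarith
    simp only [gpow, hd, this, if_true, if_false]; ring

lemma gpow_PP {a r s : ℝ} (ha : 0 < a) (ha2 : a < 1 / 2) (hrs : r ≠ s) :
    Integrable (fun x => gpow (a - 1) (x - r) * gpow (a - 1) (x - s)) ∧
    ∫ x, gpow (a - 1) (x - r) * gpow (a - 1) (x - s) =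
      Real.Gamma a * Real.Gamma (1 - 2 * a) / Real.Gamma (1 - a) *
        (gpow (2 * a - 1) (s - r) + gpow (2 * a - 1) (r - s)) := by
  rcases lt_or_gt_of_ne hrs with h | h
  · exact gpow_PP_lt ha ha2 h
  · have := gpow_PP_lt ha ha2 h
    rw [add_comm (gpow (2 * a - 1) (s - r))]
    simpa only [mul_comm (gpow (a - 1) (_ - r))] using this

lemma gpow_QQ {a r s : ℝ} (ha : 0 < a) (ha2 : a < 1 / 2) (hrs : r ≠ s) :
    Integrable (fun x => gpow (a - 1) (r - x) * gpow (a - 1) (s - x)) ∧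
    ∫ x, gpow (a - 1) (r - x) * gpow (a - 1) (s - x) =
      Real.Gamma a * Real.Gamma (1 - 2 * a) / Real.Gamma (1 - a) *
        (gpow (2 * a - 1) (s - r) + gpow (2 * a - 1) (r - s)) := by
  obtain ⟨h1, h2⟩ := gpow_PP ha ha2 hrs
  have e : (fun x => gpow (a - 1) (r - x) * gpow (a - 1) (s - x)) = fun x =>
      (fun y => gpow (a - 1) (y - r) * gpow (a - 1) (y - s)) (r + s - x) := by
    ext x
    simp only
    rw [show r + s - x - r = s - x by ring, show r + s - x - s = r - x by ring, mul_comm]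
  rw [e]
  exact ⟨h1.comp_sub_left (r + s), (integral_sub_left_eq_self
    (fun y => gpow (a - 1) (y - r) * gpow (a - 1) (y - s)) volume (r + s)).trans h2⟩

lemma gpow_PQ {a r s : ℝ} (ha : 0 < a) (ha2 : a < 1 / 2) :
    Integrable (fun x => gpow (a - 1) (x - r) * gpow (a - 1) (s - x)) ∧
    ∫ x, gpow (a - 1) (x - r) * gpow (a - 1) (s - x) =
      Real.Gamma a * Real.Gamma a / Real.Gamma (2 * a) * gpow (2 * a - 1) (s - r) := by
  by_cases hd : 0 < s - r
  · obtain ⟨h1, h2⟩ := betaFin ha hd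
    have e : (fun x => gpow (a - 1) (x - r) * gpow (a - 1) (s - x)) = fun x =>
        (Set.Ioc (0:ℝ) (s - r)).indicator
          (fun y : ℝ => y ^ (a - 1) * ((s - r) - y) ^ (a - 1)) (x - r) := by
      ext x
      by_cases h : x - r ∈ Set.Ioc 0 (s - r)
      · rw [Set.indicator_of_mem h]
        have h0 : 0 < x - r := h.1
        rw [show s - r - (x - r) = s - x by ring]
        simp only [gpow, h0, if_true]
        split_ifs with h3
        · rfl
        · have : s - x = 0 := by linarith [h.2]
          rw [this, Real.zero_rpow (by linarith)]
      · rw [Set.indicator_of_notMem h]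
        rw [Set.mem_Ioc, not_and_or] at h
        rcases h with h | h
        · simp only [gpow, h, if_false, zero_mul]
        · have : ¬ 0 < s - x := by linarith
          simp only [gpow, this, if_false, mul_zero]
    rw [e]
    constructor
    · exact (h1.integrable_indicator measurableSet_Ioc).comp_sub_right r
    · rw [integral_sub_right_eq_self, integral_indicator measurableSet_Ioc, h2]
      simp only [gpow, hd, if_true]
  · have e : (fun x => gpow (a - 1) (x - r) * gpow (a - 1) (s - x)) = fun x => 0 := by
      ext x
      by_cases h : 0 < x - r
      · have : ¬ 0 < s - x := by linarith
        simp only [gpow, this, if_false, mul_zero]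
      · simp only [gpow, h, if_false, zero_mul]
    rw [e]
    simp [gpow, hd]

/-- the bilinear form -/
noncomputable def Jf {H : Type*} [NormedAddCommGroup H] [InnerProductSpace ℝ H] (c t : ℝ)
    (v w : ℝ → H) : ℝ :=
  ∫ p, gpow c (p.2 - p.1) * ⟪v p.1, w p.2⟫
    ∂((volume.restrict (Set.Ioc 0 t)).prod (volume.restrict (Set.Ioc 0 t)))

open Set in
lemma Jf_integrable {H : Type*} [NormedAddCommGroup H] [InnerProductSpace ℝ H] {c : ℝ} (hc : -1 < c)
    (t : ℝ) (v w : ℝ → H) (hv : Continuous v) (hw : Continuous w) :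
    Integrable (fun p : ℝ × ℝ => gpow c (p.2 - p.1) * ⟪v p.1, w p.2⟫)
      ((volume.restrict (Set.Ioc 0 t)).prod (volume.restrict (Set.Ioc 0 t))) := by
  obtain ⟨C, hC⟩ : ∃ C, ∀ p ∈ (Icc 0 t ×ˢ Icc 0 t : Set (ℝ × ℝ)), ‖⟪v p.1, w p.2⟫‖ ≤ C :=
    (isCompact_Icc.prod isCompact_Icc).exists_bound_of_continuousOn
      (f := fun p : ℝ × ℝ => ⟪v p.1, w p.2⟫) (by fun_prop)
  refine (gpow_int2 hc t).mul_bdd (c := C) ?_ ?_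
  · have : Continuous (fun q : (ℝ × ℝ) => ⟪v q.1, w q.2⟫) := by fun_prop
    exact this.aestronglyMeasurable
  · rw [Measure.prod_restrict]
    filter_upwards [ae_restrict_mem (measurableSet_Ioc.prod measurableSet_Ioc)] with p hp
    exact hC p ⟨Ioc_subset_Icc_self hp.1, Ioc_subset_Icc_self hp.2⟩

open Set in
lemma fracInt_eq_Jf {H : Type*} [NormedAddCommGroup H] [InnerProductSpace ℝ H] [CompleteSpace H]
    {β : ℝ} (hβ : 0 < β) (t : ℝ) (ht : 0 < t) (v w : ℝ → H) (hv : Continuous v) (hw : Continuous w) :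
    ∫ s in (0:ℝ)..t, ⟪fracInt β v s, w s⟫ = (Real.Gamma β)⁻¹ * Jf (β - 1) t v w := by
  have hc : -1 < β - 1 := by linarith
  rw [Jf, integral_prod_symm _ (Jf_integrable hc t v w hv hw),
    intervalIntegral.integral_of_le ht.le, ← integral_const_mul]
  apply setIntegral_congr_fun measurableSet_Ioc
  intro s hs
  have e : fracInt β v s = (Real.Gamma β)⁻¹ • ∫ r in Ioc 0 t, gpow (β - 1) (s - r) • v r := by
    rw [fracInt, intervalIntegral.integral_of_le hs.1.le, ← integral_smul]
    rw [integral_Ioc_eq_integral_Ioo, ← integral_indicator measurableSet_Ioo,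
      ← integral_indicator measurableSet_Ioc]
    congr 1
    ext r
    by_cases h : r ∈ Ioo 0 s
    · rw [indicator_of_mem h, indicator_of_mem (show r ∈ Ioc 0 t from ⟨h.1, by linarith [h.2, hs.2]⟩)]
      have : 0 < s - r := by linarith [h.2]
      simp only [gpow, this, if_true, smul_smul]
      congr 1
      ring
    · rw [indicator_of_notMem h]
      by_cases h' : r ∈ Ioc 0 t
      · rw [indicator_of_mem h']
        have : ¬ 0 < s - r := fun h2 => h ⟨h'.1, by linarith⟩
        simp only [gpow, this, if_false, zero_smul, smul_zero]
      · rw [indicator_of_notMem h']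
  simp only [e]
  rw [real_inner_smul_left, real_inner_comm, ← integral_inner (gpow_int_right hc v hv t s)]
  congr 2
  ext r
  rw [real_inner_smul_right, real_inner_comm]

lemma Jf_symm {H : Type*} [NormedAddCommGroup H] [InnerProductSpace ℝ H] {c : ℝ} (hc : -1 < c)
    (A t : ℝ) (v : ℝ → H) (hv : Continuous v) :
    ∫ p, (A * (gpow c (p.2 - p.1) + gpow c (p.1 - p.2))) * ⟪v p.1, v p.2⟫
    ∂((volume.restrict (Set.Ioc 0 t)).prod (volume.restrict (Set.Ioc 0 t))) = 2 * A * Jf c t v v := by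
  have h := Jf_integrable hc t v v hv hv
  have e : ∀ p : ℝ × ℝ, (A * (gpow c (p.2 - p.1) + gpow c (p.1 - p.2))) * ⟪v p.1, v p.2⟫ =
    A * (gpow c (p.2 - p.1) * ⟪v p.1, v p.2⟫ + gpow c (p.swap.2 - p.swap.1) * ⟪v p.swap.1, v p.swap.2⟫) := by
    intro p
    simp only [Prod.snd_swap, Prod.fst_swap]
    rw [real_inner_comm (v p.1) (v p.2)]; ring
  simp only [e]
  rw [integral_const_mul, integral_add h (by exact h.swap),
    integral_prod_swap (fun p : ℝ × ℝ => gpow c (p.2 - p.1) * ⟪v p.1, v p.2⟫), Jf]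
  ring

lemma ae_ne_diag (t : ℝ) : ∀ᵐ p ∂((volume.restrict (Set.Ioc (0:ℝ) t)).prod
    (volume.restrict (Set.Ioc (0:ℝ) t))), p.1 ≠ p.2 := by
  rw [ae_iff]
  have hm : MeasurableSet {p : ℝ × ℝ | ¬ p.1 ≠ p.2} := by
    simpa using measurableSet_eq_fun measurable_fst measurable_snd
  rw [Measure.measure_prod_null hm]
  refine Filter.Eventually.of_forall fun x => ?_
  have : Prod.mk x ⁻¹' {p : ℝ × ℝ | ¬ p.1 ≠ p.2} = {x} := by ext y; simp [eq_comm]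
  simp only [this]; simp

lemma cs_aux {H : Type*} [NormedAddCommGroup H] [InnerProductSpace ℝ H] (P Q : ℝ → H)
    (h1 : Integrable (fun x => ⟪P x, Q x⟫)) (h2 : Integrable (fun x => ⟪P x, P x⟫))
    (h3 : Integrable (fun x => ⟪Q x, Q x⟫)) :
    ∫ x, ⟪P x, Q x⟫ ≤ Real.sqrt (∫ x, ⟪P x, P x⟫) * Real.sqrt (∫ x, ⟪Q x, Q x⟫) := by
  have hA : 0 ≤ ∫ x, ⟪P x, P x⟫ := integral_nonneg fun x => real_inner_self_nonneg
  have key : ∀ c : ℝ, 0 ≤ (∫ x, ⟪P x, P x⟫) * (c * c) + (2 * ∫ x, ⟪P x, Q x⟫) * c + ∫ x, ⟪Q x, Q x⟫ := by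
    intro c
    have : ∫ x, ⟪c • P x + Q x, c • P x + Q x⟫ =
        (∫ x, ⟪P x, P x⟫) * (c * c) + (2 * ∫ x, ⟪P x, Q x⟫) * c + ∫ x, ⟪Q x, Q x⟫ := by
      have e : ∀ x, ⟪c • P x + Q x, c • P x + Q x⟫ =
          ((c * c) * ⟪P x, P x⟫ + (2 * c) * ⟪P x, Q x⟫) + ⟪Q x, Q x⟫ := by
        intro x
        simp only [inner_add_left, inner_add_right, real_inner_smul_left, real_inner_smul_right]
        rw [real_inner_comm (P x) (Q x)]; ring
      simp only [e]
      rw [integral_add (by exact (h2.const_mul (c * c)).add (h1.const_mul (2 * c))) h3,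
        integral_add (h2.const_mul _) (h1.const_mul _), integral_const_mul, integral_const_mul]
      ring
    rw [← this]
    exact integral_nonneg fun x => real_inner_self_nonneg
  have hd := discrim_le_zero key
  rw [discrim] at hd
  rw [← Real.sqrt_mul hA]
  apply Real.le_sqrt_of_sq_le
  nlinarith

/-- Cauchy–Schwarz type continuity bound for the fractional-integral bilinear form:
`I(⟨I^{1-α}v, w⟩)(t) ≤ (1/α) (I(⟨I^{1-α}v, v⟩)(t))^{1/2} (I(⟨I^{1-α}w, w⟩)(t))^{1/2}`. -/
theorem fracInt_bilinear_cauchy_schwarz {H : Type*} [NormedAddCommGroup H]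
    [InnerProductSpace ℝ H] [CompleteSpace H]
    (α : ℝ) (hα : 0 < α) (hα1 : α ≤ 1) (t : ℝ) (ht : 0 < t)
    (v w : ℝ → H) (hv : Continuous v) (hw : Continuous w) :
    (∫ s in (0:ℝ)..t, ⟪fracInt (1 - α) v s, w s⟫)
      ≤ (1 / α) * Real.sqrt (∫ s in (0:ℝ)..t, ⟪fracInt (1 - α) v s, v s⟫)
          * Real.sqrt (∫ s in (0:ℝ)..t, ⟪fracInt (1 - α) w s, w s⟫) := by
  rcases eq_or_lt_of_le hα1 with h | hlt
  · subst h
    simp [fracInt]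
  set a : ℝ := (1 - α) / 2 with ha_def
  have ha : 0 < a := by rw [ha_def]; linarith
  have ha2 : a < 1 / 2 := by rw [ha_def]; linarith
  have hβ : 1 - α = 2 * a := by rw [ha_def]; ring
  have hα' : α = 1 - 2 * a := by linarith
  rw [hβ, fracInt_eq_Jf (by linarith) t ht v w hv hw, fracInt_eq_Jf (by linarith) t ht v v hv hv,
    fracInt_eq_Jf (by linarith) t ht w w hw hw]
  have hk : 0 < (Real.Gamma (2 * a))⁻¹ := inv_pos.2 (Real.Gamma_pos_of_pos (by linarith))
  set k := (Real.Gamma (2 * a))⁻¹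
  have hc : -1 < a - 1 := by linarith
  have hc2 : -1 < 2 * a - 1 := by linarith
  have m1 : Measurable (Function.uncurry fun x r : ℝ => gpow (a - 1) (x - r)) :=
    (gpow_meas _).comp (measurable_fst.sub measurable_snd)
  have m2 : Measurable (Function.uncurry fun x r : ℝ => gpow (a - 1) (r - x)) :=
    (gpow_meas _).comp (measurable_snd.sub measurable_fst)
  have hg := gam_const ha ha2
  have hG := Real.Gamma_pos_of_pos ha
  have hG2 : 0 < Real.Gamma (2 * a) := Real.Gamma_pos_of_pos (by linarith)
  have hG3 : 0 < Real.Gamma (1 - a) := Real.Gamma_pos_of_pos (by linarith)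
  have hG4 : 0 < Real.Gamma (1 - 2 * a) := Real.Gamma_pos_of_pos (by linarith)
  have hi2 := gpow_int2 hc2 t
  have PP := fun r s : ℝ => gpow_PP (r := r) (s := s) ha ha2
  have QQ := fun r s : ℝ => gpow_QQ (r := r) (s := s) ha ha2
  have PQ := fun r s : ℝ => gpow_PQ (r := r) (s := s) ha ha2
  have hA : 0 < Real.Gamma a * Real.Gamma (1 - 2 * a) / Real.Gamma (1 - a) := by positivity
  have hB : 0 < Real.Gamma a * Real.Gamma a / Real.Gamma (2 * a) := by positivity
  generalize Real.Gamma a * Real.Gamma (1 - 2 * a) / Real.Gamma (1 - a) = A at *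
  generalize Real.Gamma a * Real.Gamma a / Real.Gamma (2 * a) = B at *
  obtain ⟨i1, e1⟩ := fubK t v w hv hw (fun x r => gpow (a - 1) (x - r)) (fun x r => gpow (a - 1) (r - x))
    m1 m2 (fun _ _ => gpow_nonneg _ _) (fun _ _ => gpow_nonneg _ _)
    (fun x => gpow_int_right hc v hv t x) (fun x => gpow_int_left hc w hw t x)
    (fun p => B * gpow (2 * a - 1) (p.2 - p.1)) (hi2.const_mul B)
    (Filter.Eventually.of_forall fun p => PQ p.1 p.2)
  have hMs : Integrable (fun p : ℝ × ℝ => A * (gpow (2 * a - 1) (p.2 - p.1) + gpow (2 * a - 1) (p.1 - p.2)))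
      ((volume.restrict (Set.Ioc 0 t)).prod (volume.restrict (Set.Ioc 0 t))) :=
    (hi2.add hi2.swap).const_mul A
  obtain ⟨i2, e2⟩ := fubK t v v hv hv (fun x r => gpow (a - 1) (x - r)) (fun x r => gpow (a - 1) (x - r))
    m1 m1 (fun _ _ => gpow_nonneg _ _) (fun _ _ => gpow_nonneg _ _)
    (fun x => gpow_int_right hc v hv t x) (fun x => gpow_int_right hc v hv t x)
    _ hMs ((ae_ne_diag t).mono fun p hp => PP p.1 p.2 hp)
  obtain ⟨i3, e3⟩ := fubK t w w hw hw (fun x r => gpow (a - 1) (r - x)) (fun x r => gpow (a - 1) (r - x))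
    m2 m2 (fun _ _ => gpow_nonneg _ _) (fun _ _ => gpow_nonneg _ _)
    (fun x => gpow_int_left hc w hw t x) (fun x => gpow_int_left hc w hw t x)
    _ hMs ((ae_ne_diag t).mono fun p hp => QQ p.1 p.2 hp)
  have hcs := cs_aux _ _ i1 i2 i3
  rw [Jf_symm hc2 A t v hv] at e2
  rw [Jf_symm hc2 A t w hw] at e3
  simp only [mul_assoc B] at e1
  rw [integral_const_mul] at e1
  change _ = B * Jf (2 * a - 1) t v w at e1
  rw [e1, e2, e3, Real.sqrt_mul (show 0 ≤ 2 * A by positivity),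
    Real.sqrt_mul (show 0 ≤ 2 * A by positivity)] at hcs
  rw [Real.sqrt_mul hk.le, Real.sqrt_mul hk.le]
  set X := Real.sqrt (Jf (2 * a - 1) t v v)
  set Y := Real.sqrt (Jf (2 * a - 1) t w w)
  have hX : 0 ≤ X := Real.sqrt_nonneg _
  have hY : 0 ≤ Y := Real.sqrt_nonneg _
  have s1 : Real.sqrt (2 * A) * X * (Real.sqrt (2 * A) * Y) = 2 * A * (X * Y) := by
    rw [← Real.mul_self_sqrt (show 0 ≤ 2 * A by positivity)]
    rw [Real.sqrt_mul_self (Real.sqrt_nonneg _)]; ring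
  have s2 : 1 / α * (Real.sqrt k * X) * (Real.sqrt k * Y) = k * (X * Y / α) := by
    have := Real.mul_self_sqrt hk.le
    linear_combination (X * Y / α) * this
  rw [s1] at hcs
  rw [s2]
  gcongr
  rw [le_div_iff₀ hα]
  rw [← hα'] at hg
  have hXY : 0 ≤ X * Y := by positivity
  refine le_of_mul_le_mul_left ?_ hB
  calc B * (Jf (2 * a - 1) t v w * α) = (B * Jf (2 * a - 1) t v w) * α := by ring
    _ ≤ (2 * A * (X * Y)) * α := by gcongr
    _ = (2 * A * α) * (X * Y) := by ring
    _ ≤ B * (X * Y) := by gcongr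
end

section
/- α-robust interpolation estimate: Let X₀ = L²(0,T;Y) and X₁ = {u ∈ X₀ : u' ∈ X₀, u(0)=0} with norm ‖u‖_{X₁} = ‖u'‖_{X₀}. Let B : X₀ + X₁ → Z be linear with ‖Bu‖_Z ≤ M₀‖u‖_{X₀} for u ∈ X₀ and ‖Bu‖_Z ≤ M₁‖u‖_{X₁} for u ∈ X₁. Then for 0 < α < 1, ‖Bu‖_Z ≤ e^{1+(π/4)²} M₀^{1−α} M₁^{α} ‖D₀^{α} u‖_{X₀} whenever D₀^α u ∈ X₀, where D₀^α u = I^{1−α} u' is the fractional derivative of order α. -/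
open MeasureTheory Set Real

lemma air_chord {a b c : ℝ} (ha : 0 < a) (hab : a < b) (hbc : b < c) :
    (c - a) * Real.Gamma b ≤ (c - b) * Real.Gamma a + (b - a) * Real.Gamma c := by
  have hca : 0 < c - a := by linarith
  have h := Real.convexOn_Gamma.2 (show a ∈ Ioi 0 from ha) (show c ∈ Ioi 0 from by simp; linarith)
    (show 0 ≤ (c - b) / (c - a) from div_nonneg (by linarith) hca.le)
    (show 0 ≤ (b - a) / (c - a) from div_nonneg (by linarith) hca.le) (by field_simp; ring)
  simp only [smul_eq_mul] at h
  have e : (c - b) / (c - a) * a + (b - a) / (c - a) * c = b := by field_simp; ring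
  rw [e] at h
  have := mul_le_mul_of_nonneg_left h hca.le
  calc _ ≤ _ := this
    _ = _ := by field_simp

lemma air_gamma {α : ℝ} (hα : 0 < α) (hα1 : α < 1) : (0.8 : ℝ) ≤ Real.Gamma (α + 1) := by
  have hpi1 := Real.pi_gt_d4
  have hpi2 := Real.pi_lt_d4
  have s1 : (1.772 : ℝ) ≤ √π := Real.le_sqrt_of_sq_le (by linarith)
  have s2 : √π ≤ (1.773 : ℝ) := Real.sqrt_le_iff.2 ⟨by norm_num, by linarith⟩
  have g1 : Real.Gamma (1/2) = √π := Real.Gamma_one_half_eq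
  have g2 : Real.Gamma (3/2) = √π / 2 := by
    rw [show (3/2 : ℝ) = 1/2 + 1 by norm_num, Real.Gamma_add_one (by norm_num), g1]; ring
  have g3 : Real.Gamma (5/2) = 3 * √π / 4 := by
    rw [show (5/2 : ℝ) = 3/2 + 1 by norm_num, Real.Gamma_add_one (by norm_num), g2]; ring
  have g4 : Real.Gamma 1 = 1 := Real.Gamma_one
  have g5 : Real.Gamma 2 = 1 := Real.Gamma_two
  rcases lt_trichotomy α (1/2) with h | h | h
  · have h1 := air_chord (a := 1/2) (b := 1) (c := α + 1) (by norm_num) (by norm_num) (by linarith)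
    have h2 := air_chord (a := α + 1) (b := 3/2) (c := 2) (by linarith) (by linarith) (by norm_num)
    rw [g1, g4] at h1
    rw [g2, g5] at h2
    nlinarith
  · rw [h, show (1/2 : ℝ) + 1 = 3/2 by norm_num, g2]; linarith
  · have h1 := air_chord (a := 1) (b := 3/2) (c := α + 1) (by norm_num) (by norm_num) (by linarith)
    have h2 := air_chord (a := α + 1) (b := 2) (c := 5/2) (by linarith) (by linarith) (by norm_num)
    rw [g2, g4] at h1
    rw [g3, g5] at h2
    nlinarith

lemma air_exp : (5 : ℝ) ≤ Real.exp (1 + (π / 4) ^ 2) := by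
  have hpi1 := Real.pi_gt_d4
  have h1 : (0.616 : ℝ) ≤ (π / 4) ^ 2 := by nlinarith
  have h2 : Real.exp (1 + 0.616) ≤ Real.exp (1 + (π / 4) ^ 2) := Real.exp_le_exp.2 (by linarith)
  have h3 := Real.sum_le_exp_of_nonneg (x := 0.616) (by norm_num) 4
  rw [Real.exp_add] at h2
  have h4 := Real.exp_one_gt_d9
  simp [Finset.sum_range_succ, Nat.factorial] at h3
  norm_num at *
  nlinarith

lemma air_beta {α x : ℝ} (hα : 0 < α) (hα1 : α < 1) (hx : 0 < x) :
    ∫ s in (0:ℝ)..x, (s ^ (α - 1) / Real.Gamma α) * ((x - s) ^ (-α) / Real.Gamma (1 - α)) = 1 := by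
  have hb := Complex.betaIntegral_scaled (α : ℂ) ((1 - α : ℝ) : ℂ) hx
  have hg := Complex.Gamma_mul_Gamma_eq_betaIntegral (s := (α : ℂ)) (t := ((1 - α : ℝ) : ℂ))
    (by simpa using hα) (by rw [Complex.ofReal_re]; linarith)
  have e1 : (α : ℂ) + ((1 - α : ℝ) : ℂ) = 1 := by push_cast; ring
  rw [e1, Complex.Gamma_one, one_mul, Complex.Gamma_ofReal, Complex.Gamma_ofReal] at hg
  rw [e1, ← hg, sub_self, Complex.cpow_zero, one_mul] at hb
  have hc : ∫ s in (0:ℝ)..x, (s ^ (α - 1)) * ((x - s) ^ (-α)) = Real.Gamma α * Real.Gamma (1 - α) := by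
    have : ((∫ s in (0:ℝ)..x, (s ^ (α - 1)) * ((x - s) ^ (-α)) : ℝ) : ℂ)
        = ((Real.Gamma α * Real.Gamma (1 - α) : ℝ) : ℂ) := by
      rw [← intervalIntegral.integral_ofReal]
      push_cast
      rw [← hb]
      apply intervalIntegral.integral_congr
      intro s hs
      rw [uIcc_of_le hx.le] at hs
      simp only
      rw [Complex.ofReal_cpow hs.1, Complex.ofReal_cpow (by linarith [hs.2])]
      push_cast
      congr 2
      ring
    exact_mod_cast this
  have p1 := Real.Gamma_pos_of_pos hα
  have p2 := Real.Gamma_pos_of_pos (sub_pos.2 hα1)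
  calc _ = ∫ s in (0:ℝ)..x, (Real.Gamma α * Real.Gamma (1 - α))⁻¹ * ((s ^ (α - 1)) * ((x - s) ^ (-α))) := by
        congr 1; ext s; field_simp
    _ = 1 := by rw [intervalIntegral.integral_const_mul, hc]; field_simp

lemma air_young_pt {Y : Type*} [NormedAddCommGroup Y] [NormedSpace ℝ Y]
    {k : ℝ → ℝ} {g : ℝ → Y} (hk : Integrable k) (hg : AEStronglyMeasurable g) {C : ℝ}
    (hC : ∀ x, ‖g x‖ ≤ C) (t : ℝ) :
    ‖∫ s, k s • g (t - s)‖ ^ 2 ≤ (∫ s, ‖k s‖) * ∫ s, ‖k s‖ * ‖g (t - s)‖ ^ 2 := by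
  have hgm : AEStronglyMeasurable (fun s => g (t - s)) :=
    hg.comp_quasiMeasurePreserving (quasiMeasurePreserving_sub_left volume t)
  have i1 : Integrable (fun s => ‖k s‖ * ‖g (t - s)‖) :=
    hk.norm.mul_bdd (c := C) hgm.norm (Filter.Eventually.of_forall fun s => by simpa using hC _)
  have i2 : Integrable (fun s => ‖k s‖ * ‖g (t - s)‖ ^ 2) :=
    hk.norm.mul_bdd (c := C ^ 2) (hgm.norm.pow 2) (Filter.Eventually.of_forall fun s => by
      simp only [norm_pow, norm_norm]; gcongr; exact hC _)
  set A := ∫ s, ‖k s‖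
  set P := ∫ s, ‖k s‖ * ‖g (t - s)‖ ^ 2
  set c := ∫ s, ‖k s‖ * ‖g (t - s)‖
  have hA : 0 ≤ A := integral_nonneg fun s => norm_nonneg _
  have hP : 0 ≤ P := integral_nonneg fun s => by positivity
  have hc : 0 ≤ c := integral_nonneg fun s => by positivity
  have h1 : ‖∫ s, k s • g (t - s)‖ ≤ c := by
    refine (norm_integral_le_integral_norm _).trans (le_of_eq ?_)
    simp [c, norm_smul]
  have h2 : ∀ m : ℝ, 0 ≤ P - 2 * m * c + m ^ 2 * A := by
    intro m
    have : P - 2 * m * c + m ^ 2 * A = ∫ s, ‖k s‖ * (‖g (t - s)‖ - m) ^ 2 := by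
      have e : ∀ s, ‖k s‖ * (‖g (t - s)‖ - m) ^ 2 = ‖k s‖ * ‖g (t - s)‖ ^ 2
          + ((-2 * m) * (‖k s‖ * ‖g (t - s)‖) + m ^ 2 * ‖k s‖) := fun s => by ring
      simp_rw [e]
      have i3 : Integrable (fun s => (-2 * m) * (‖k s‖ * ‖g (t - s)‖) + m ^ 2 * ‖k s‖) :=
        (i1.const_mul _).add (hk.norm.const_mul _)
      rw [integral_add i2 i3,
        integral_add (i1.const_mul _) (hk.norm.const_mul _), integral_const_mul, integral_const_mul]
      ring
    rw [this]
    exact integral_nonneg fun s => by positivity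
  have h3 : c ^ 2 ≤ A * P := by
    rcases hA.eq_or_lt with h0 | h0
    · have hh := h2 ((P + 1) / (2 * c))
      rcases hc.eq_or_lt with h0' | h0'
      · rw [← h0', ← h0]; simp
      · exfalso
        rw [← h0] at hh
        have : 2 * ((P + 1) / (2 * c)) * c = P + 1 := by field_simp
        linarith
    · have hh := h2 (c / A)
      have : P - 2 * (c / A) * c + (c / A) ^ 2 * A = (A * P - c ^ 2) / A := by field_simp; ring
      rw [this] at hh
      have := (div_nonneg_iff.1 hh)
      rcases this with h | h <;> linarith
  calc _ ≤ c ^ 2 := by gcongr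
    _ ≤ _ := h3

lemma air_young {Y : Type*} [NormedAddCommGroup Y] [NormedSpace ℝ Y]
    {k : ℝ → ℝ} {g W : ℝ → Y} (hk : Integrable k) (hg : Integrable g) {C : ℝ}
    (hC : ∀ x, ‖g x‖ ≤ C) {T : ℝ} (hT : 0 < T)
    (hW : ∀ᵐ t, t ∈ Ioo 0 T → W t = ∫ s, k s • g (t - s)) :
    ∫ t in (0:ℝ)..T, ‖W t‖ ^ 2 ≤ (∫ s, ‖k s‖) ^ 2 * ∫ t, ‖g t‖ ^ 2 := by
  have ig2 : Integrable (fun t => ‖g t‖ ^ 2) := by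
    simp_rw [pow_two]
    exact hg.norm.mul_bdd (c := C) hg.aestronglyMeasurable.norm
      (Filter.Eventually.of_forall fun s => by simpa using hC _)
  set R : ℝ → ℝ := fun t => ∫ s, ‖k s‖ * ‖g (t - s)‖ ^ 2
  have hR : Integrable R :=
    hk.norm.integrable_convolution (ContinuousLinearMap.mul ℝ ℝ) ig2
  have hRi : ∫ t, R t = (∫ s, ‖k s‖) * ∫ t, ‖g t‖ ^ 2 :=
    integral_convolution (ContinuousLinearMap.mul ℝ ℝ) hk.norm ig2
  have hR0 : ∀ t, 0 ≤ R t := fun t => integral_nonneg fun s => by positivity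
  rw [intervalIntegral.integral_of_le hT.le, integral_Ioc_eq_integral_Ioo]
  calc ∫ t in Ioo 0 T, ‖W t‖ ^ 2 ≤ ∫ t in Ioo 0 T, (∫ s, ‖k s‖) * R t := by
        apply integral_mono_of_nonneg (Filter.Eventually.of_forall fun t => by positivity)
          (hR.const_mul _).integrableOn
        rw [Filter.EventuallyLE, ae_restrict_iff' measurableSet_Ioo]
        filter_upwards [hW] with t ht hm
        rw [ht hm]
        exact air_young_pt hk hg.aestronglyMeasurable hC t
    _ ≤ ∫ t, (∫ s, ‖k s‖) * R t := by
        apply setIntegral_le_integral (hR.const_mul _)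
        exact Filter.Eventually.of_forall fun t =>
          mul_nonneg (integral_nonneg fun s => norm_nonneg _) (hR0 t)
    _ = _ := by rw [integral_const_mul, hRi]; ring

lemma air_int_pow {p T c : ℝ} (hp : -1 < p) (hT : 0 < T) :
    Integrable ((Ioo 0 T).indicator (fun s : ℝ => s ^ p / c)) := by
  rw [integrable_indicator_iff measurableSet_Ioo]
  have := (intervalIntegral.intervalIntegrable_rpow' (a := 0) (b := T) hp).div_const c
  rw [intervalIntegrable_iff_integrableOn_Ioo_of_le hT.le] at this
  exact this

lemma air_repr {Y : Type*} [NormedAddCommGroup Y] [NormedSpace ℝ Y] [CompleteSpace Y]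
    {T α : ℝ} (hT : 0 < T) (hα : 0 < α) (hα1 : α < 1)
    (u u' : ℝ → Y) (hu : ∀ t, HasDerivAt u (u' t) t) (hu' : Continuous u') (hu0 : u 0 = 0) :
    ∃ C : ℝ, Integrable ((Ioo 0 T).indicator (fracInt (1 - α) u')) ∧
      (∀ x, ‖(Ioo 0 T).indicator (fracInt (1 - α) u') x‖ ≤ C) ∧
      ∀ᵐ t, t < T → u (max t 0) = ∫ s, (Ioi (0:ℝ)).indicator (fun s => s ^ (α - 1) / Real.Gamma α) s •
        (Ioo 0 T).indicator (fracInt (1 - α) u') (t - s) := by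
  set f1 : ℝ → ℝ := (Ioi (0:ℝ)).indicator (fun s => s ^ (α - 1) / Real.Gamma α) with hf1
  set f1T : ℝ → ℝ := (Ioo (0:ℝ) T).indicator (fun s => s ^ (α - 1) / Real.Gamma α) with hf1T
  set f2 : ℝ → ℝ := (Ioo (0:ℝ) T).indicator (fun s => s ^ (-α) / Real.Gamma (1 - α)) with hf2
  set f3 : ℝ → Y := (Ioo (0:ℝ) T).indicator u' with hf3
  set g1 : ℝ → Y := (Ioo 0 T).indicator (fracInt (1 - α) u') with hg1
  have i1 : Integrable f1T := air_int_pow (by linarith) hT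
  have i2 : Integrable f2 := air_int_pow (by linarith) hT
  have i3 : Integrable f3 := by
    rw [hf3, integrable_indicator_iff measurableSet_Ioo]
    exact (hu'.integrableOn_Icc (a := 0) (b := T)).mono_set Ioo_subset_Icc_self
  set L : ℝ →L[ℝ] Y →L[ℝ] Y := ContinuousLinearMap.lsmul ℝ ℝ
  set G : ℝ → Y := convolution f2 f3 L volume with hG
  have iG : Integrable G := i2.integrable_convolution L i3
  -- values of G
  have G_nonpos : ∀ t ≤ 0, G t = 0 := by
    intro t ht
    have : ∀ s, L (f2 s) (f3 (t - s)) = 0 := by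
      intro s
      by_cases hs : 0 < s
      · have : f3 (t - s) = 0 := indicator_of_notMem (fun h => by linarith [h.1]) _
        rw [this, map_zero]
      · have : f2 s = 0 := indicator_of_notMem (fun h => hs h.1) _
        rw [this]; simp
    rw [hG, convolution_def]
    simp [this]
  have G_eq : ∀ t ∈ Ioo 0 T, G t = fracInt (1 - α) u' t := by
    intro t ht
    rw [hG, convolution_eq_swap, fracInt, intervalIntegral.integral_of_le ht.1.le,
      integral_Ioc_eq_integral_Ioo, ← integral_indicator measurableSet_Ioo]
    congr 1; ext s
    by_cases hs : s ∈ Ioo 0 t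
    · rw [indicator_of_mem hs]
      have h1 : f2 (t - s) = (t - s) ^ (-α) / Real.Gamma (1 - α) :=
        indicator_of_mem (show t - s ∈ Ioo 0 T from ⟨by linarith [hs.2], by linarith [hs.1, ht.2]⟩) _
      have h2 : f3 s = u' s := indicator_of_mem (show s ∈ Ioo 0 T from ⟨hs.1, by linarith [hs.2, ht.2]⟩) _
      rw [h1, h2, show 1 - α - 1 = -α by ring]
      rfl
    · rw [indicator_of_notMem hs]
      by_cases h0 : 0 < s
      · have : f2 (t - s) = 0 := indicator_of_notMem (fun h => hs ⟨h0, by linarith [h.1]⟩) _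
        rw [this]; simp
      · have : f3 s = 0 := indicator_of_notMem (fun h => h0 h.1) _
        rw [this, map_zero]
  have hg1G : g1 = (Ioo 0 T).indicator G := by
    rw [hg1]; exact (indicator_congr G_eq).symm
  -- bound
  obtain ⟨C, hC⟩ : ∃ C, ∀ x ∈ Icc 0 T, ‖u' x‖ ≤ C :=
    isCompact_Icc.exists_bound_of_continuousOn hu'.continuousOn
  have hC0 : 0 ≤ C := (norm_nonneg _).trans (hC 0 ⟨le_rfl, hT.le⟩)
  have hf3C : ∀ x, ‖f3 x‖ ≤ C := by
    intro x
    by_cases hx : x ∈ Ioo 0 T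
    · rw [hf3, indicator_of_mem hx]; exact hC x (Ioo_subset_Icc_self hx)
    · rw [hf3, indicator_of_notMem hx]; simpa using hC0
  have hGC : ∀ x, ‖G x‖ ≤ (∫ s, ‖f2 s‖) * C := by
    intro x
    rw [hG, convolution_def, ← integral_mul_const]
    apply norm_integral_le_of_norm_le (i2.norm.mul_const _)
    refine Filter.Eventually.of_forall fun s => ?_
    change ‖f2 s • f3 (x - s)‖ ≤ _
    rw [norm_smul]
    gcongr
    exact hf3C _
  refine ⟨(∫ s, ‖f2 s‖) * C, ?_, ?_, ?_⟩
  · rw [hg1G]; exact iG.indicator measurableSet_Ioo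
  · intro x
    rw [hg1G]
    exact (norm_indicator_le_norm_self _ _).trans (hGC x)
  -- representation
  have hassoc : ∀ᵐ t, convolution (convolution f1T f2 (ContinuousLinearMap.mul ℝ ℝ) volume) f3 L volume t
      = convolution f1T G L volume t := by
    have hn : Integrable (convolution (fun x => ‖f2 x‖) (fun x => ‖f3 x‖) (ContinuousLinearMap.mul ℝ ℝ) volume) :=
      i2.norm.integrable_convolution _ i3.norm
    filter_upwards [i1.norm.ae_convolution_exists (ContinuousLinearMap.mul ℝ ℝ) hn] with t ht
    exact convolution_assoc (ContinuousLinearMap.mul ℝ ℝ) L L L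
      (fun x y z => mul_smul x y z) i1.aestronglyMeasurable i2.aestronglyMeasurable
      i3.aestronglyMeasurable (i1.ae_convolution_exists _ i2)
      (i2.norm.ae_convolution_exists _ i3.norm) ht
  filter_upwards [hassoc] with t ht htT
  rcases le_or_gt t 0 with h0 | h0
  · have : ∀ s, f1 s • g1 (t - s) = 0 := by
      intro s
      by_cases hs : 0 < s
      · have : g1 (t - s) = 0 := indicator_of_notMem (fun h => by linarith [h.1]) _
        rw [this, smul_zero]
      · have : f1 s = 0 := indicator_of_notMem (fun h => hs h) _
        rw [this, zero_smul]
    simp [this, max_eq_right h0, hu0]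
  rw [max_eq_left h0.le]
  have e1 : ∫ s, f1 s • g1 (t - s) = convolution f1T G L volume t := by
    rw [convolution_def]
    congr 1; ext s
    change _ = f1T s • G (t - s)
    by_cases hs : 0 < s
    · by_cases hst : s < t
      · have h1 : f1 s = f1T s := by
          rw [hf1, hf1T, indicator_of_mem (show s ∈ Ioi 0 from hs), indicator_of_mem (show s ∈ Ioo 0 T from ⟨hs, hst.trans htT⟩)]
        rw [h1, hg1G, indicator_of_mem (show t - s ∈ Ioo 0 T from ⟨by linarith, by linarith⟩)]
      · rw [G_nonpos _ (by linarith), hg1, indicator_of_notMem (fun h => hst (by linarith [h.1]))]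
        simp
    · have h1 : f1 s = 0 := indicator_of_notMem (fun h => hs h) _
      have h2 : f1T s = 0 := indicator_of_notMem (fun h => hs h.1) _
      rw [h1, h2]; simp
  rw [e1, ← ht, convolution_def]
  have e2 : ∀ s, L (convolution f1T f2 (ContinuousLinearMap.mul ℝ ℝ) volume s) (f3 (t - s))
      = (Ioo 0 t).indicator (fun s => u' (t - s)) s := by
    intro s
    by_cases hs : 0 < s
    · by_cases hst : s < t
      · have hc : convolution f1T f2 (ContinuousLinearMap.mul ℝ ℝ) volume s = 1 := by
          rw [convolution_def, ← air_beta hα hα1 hs, intervalIntegral.integral_of_le hs.le,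
            integral_Ioc_eq_integral_Ioo, ← integral_indicator measurableSet_Ioo]
          congr 1; ext r
          by_cases hr : r ∈ Ioo 0 s
          · have h1 : f1T r = r ^ (α - 1) / Real.Gamma α :=
              indicator_of_mem (show r ∈ Ioo 0 T from ⟨hr.1, by linarith [hr.2]⟩) _
            have h2 : f2 (s - r) = (s - r) ^ (-α) / Real.Gamma (1 - α) :=
              indicator_of_mem (show s - r ∈ Ioo 0 T from ⟨by linarith [hr.2], by linarith [hr.1]⟩) _
            rw [indicator_of_mem hr, h1, h2]; rfl
          · rw [indicator_of_notMem hr]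
            by_cases hr0 : 0 < r
            · have : f2 (s - r) = 0 := indicator_of_notMem (fun h => hr ⟨hr0, by linarith [h.1]⟩) _
              rw [this, map_zero]
            · have : f1T r = 0 := indicator_of_notMem (fun h => hr0 h.1) _
              rw [this]; simp
        rw [hc, indicator_of_mem (show s ∈ Ioo 0 t from ⟨hs, hst⟩), hf3, indicator_of_mem (show t - s ∈ Ioo 0 T from ⟨by linarith, by linarith⟩)]
        simp [L]
      · rw [indicator_of_notMem (fun h => hst h.2), hf3,
          indicator_of_notMem (fun h => hst (by linarith [h.1])), map_zero]
    · have hc : convolution f1T f2 (ContinuousLinearMap.mul ℝ ℝ) volume s = 0 := by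
        rw [convolution_def]
        have : ∀ r, (ContinuousLinearMap.mul ℝ ℝ) (f1T r) (f2 (s - r)) = 0 := by
          intro r
          by_cases hr0 : 0 < r
          · have : f2 (s - r) = 0 := indicator_of_notMem (fun h => hs (by linarith [h.1])) _
            rw [this, map_zero]
          · have : f1T r = 0 := indicator_of_notMem (fun h => hr0 h.1) _
            rw [this]; simp
        simp [this]
      rw [hc, indicator_of_notMem (fun h => hs h.1)]; simp
  simp_rw [e2]
  rw [integral_indicator measurableSet_Ioo, ← integral_Ioc_eq_integral_Ioo,
    ← intervalIntegral.integral_of_le h0.le, intervalIntegral.integral_comp_sub_left (fun s => u' s) t,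
    sub_self, sub_zero, intervalIntegral.integral_eq_sub_of_hasDerivAt (fun x _ => hu x)
      (hu'.intervalIntegrable _ _), hu0, sub_zero]

lemma air_kernel {α r L : ℝ} (hα : 0 < α) (hα1 : α < 1) (hr : 0 < r) (hL : r < L) :
    ∃ k : ℝ → ℝ, Integrable k ∧ (∫ s, ‖k s‖) ≤ 2 * r ^ α / Real.Gamma (α + 1) ∧
      ∀ s < L, k s = (Ioi (0:ℝ)).indicator (fun s => s ^ (α - 1) / Real.Gamma α) s
        - (Ioi (0:ℝ)).indicator (fun s => s ^ (α - 1) / Real.Gamma α) (s - r) := by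
  have hΓ := Real.Gamma_pos_of_pos hα
  set ω : ℝ → ℝ := fun s => s ^ (α - 1) / Real.Gamma α with hω
  have iω : ∀ a b, IntervalIntegrable ω volume a b := fun a b =>
    (intervalIntegral.intervalIntegrable_rpow' (by linarith)).div_const _
  have iω' : ∀ a b, IntervalIntegrable (fun s => ω (s - r)) volume a b := fun a b => by
    simpa using (iω (a - r) (b - r)).comp_sub_right r
  have j1 : Integrable ((Ioc 0 r).indicator ω) := by
    rw [integrable_indicator_iff measurableSet_Ioc]
    exact (intervalIntegrable_iff_integrableOn_Ioc_of_le hr.le).1 (iω 0 r)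
  have j2 : Integrable ((Ioc r L).indicator (fun s => ω (s - r) - ω s)) := by
    rw [integrable_indicator_iff measurableSet_Ioc]
    exact (intervalIntegrable_iff_integrableOn_Ioc_of_le hL.le).1 ((iω' r L).sub (iω r L))
  have n1 : ∀ s, 0 ≤ (Ioc 0 r).indicator ω s := fun s => by
    apply indicator_nonneg
    intro x hx
    exact div_nonneg (Real.rpow_nonneg hx.1.le _) hΓ.le
  have n2 : ∀ s, 0 ≤ (Ioc r L).indicator (fun s => ω (s - r) - ω s) s := fun s => by
    apply indicator_nonneg
    intro x hx
    simp only [hω, sub_nonneg]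
    have := Real.rpow_le_rpow_of_nonpos (x := x - r) (y := x) (z := α - 1)
      (by linarith [hx.1]) (by linarith) (by linarith)
    gcongr
  refine ⟨fun s => (Ioc 0 r).indicator ω s - (Ioc r L).indicator (fun s => ω (s - r) - ω s) s,
    j1.sub j2, ?_, ?_⟩
  · have hle : (∫ s, ‖(Ioc 0 r).indicator ω s - (Ioc r L).indicator (fun s => ω (s - r) - ω s) s‖)
        ≤ (∫ s, (Ioc 0 r).indicator ω s) + ∫ s, (Ioc r L).indicator (fun s => ω (s - r) - ω s) s := by
      rw [← integral_add j1 j2]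
      apply integral_mono (j1.sub j2).norm (j1.add j2)
      intro s
      refine (norm_sub_le _ _).trans (le_of_eq ?_)
      rw [Real.norm_of_nonneg (n1 s), Real.norm_of_nonneg (n2 s)]
      rfl
    refine hle.trans ?_
    have hint : ∀ a b : ℝ, ∫ s in a..b, ω s = (b ^ α - a ^ α) / Real.Gamma (α + 1) := by
      intro a b
      simp only [hω]
      rw [intervalIntegral.integral_div, integral_rpow (Or.inl (by linarith)),
        Real.Gamma_add_one hα.ne']
      simp only [sub_add_cancel]
      field_simp
    rw [integral_indicator measurableSet_Ioc, integral_indicator measurableSet_Ioc,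
      ← intervalIntegral.integral_of_le hr.le, ← intervalIntegral.integral_of_le hL.le,
      intervalIntegral.integral_sub (iω' _ _) (iω _ _),
      intervalIntegral.integral_comp_sub_right (fun s => ω s), hint, hint, hint, sub_self,
      Real.zero_rpow hα.ne', ← sub_div, ← add_div]
    have hG := Real.Gamma_pos_of_pos (show 0 < α + 1 by linarith)
    have : (L - r) ^ α ≤ L ^ α := Real.rpow_le_rpow (by linarith) (by linarith) hα.le
    gcongr
    linarith
  · intro s hs
    simp only
    by_cases h0 : 0 < s
    · by_cases h1 : s ≤ r
      · rw [indicator_of_mem (show s ∈ Ioc 0 r from ⟨h0, h1⟩), indicator_of_notMem (fun h => by linarith [h.1]),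
          indicator_of_mem (show s ∈ Ioi 0 from h0),
          indicator_of_notMem (fun h => by linarith [show 0 < s - r from h])]
      · push Not at h1
        rw [indicator_of_notMem (fun h => by linarith [h.2]),
          indicator_of_mem (show s ∈ Ioc r L from ⟨h1, hs.le⟩),
          indicator_of_mem (show s ∈ Ioi 0 from h0),
          indicator_of_mem (show s - r ∈ Ioi 0 from by simpa using h1)]
        ring
    · rw [indicator_of_notMem (fun h => h0 h.1), indicator_of_notMem (fun h => by linarith [h.1]),
          indicator_of_notMem (show s ∉ Ioi 0 from fun h => h0 h),
          indicator_of_notMem (show s - r ∉ Ioi 0 from fun h => by linarith [show 0 < s - r from h])]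

lemma air_diff {Y : Type*} [NormedAddCommGroup Y] [NormedSpace ℝ Y] [CompleteSpace Y]
    {T α r : ℝ} (hT : 0 < T) (hα : 0 < α) (hα1 : α < 1) (hr : 0 < r)
    (u u' : ℝ → Y) (hu : ∀ t, HasDerivAt u (u' t) t) (hu' : Continuous u') (hu0 : u 0 = 0) :
    ∫ t in (0:ℝ)..T, ‖u (max t 0) - u (max (t - r) 0)‖ ^ 2 ≤
      (2 * r ^ α / Real.Gamma (α + 1)) ^ 2 * ∫ t in (0:ℝ)..T, ‖fracInt (1 - α) u' t‖ ^ 2 := by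
  obtain ⟨C, ig, hC, hrep⟩ := air_repr hT hα hα1 u u' hu hu' hu0
  obtain ⟨k, ik, hk, hkeq⟩ := air_kernel (L := T + r) hα hα1 hr (by linarith)
  set g1 : ℝ → Y := (Ioo 0 T).indicator (fracInt (1 - α) u') with hg1
  set f1 : ℝ → ℝ := (Ioi (0:ℝ)).indicator (fun s => s ^ (α - 1) / Real.Gamma α) with hf1
  have hrep' : ∀ᵐ t, t - r < T → u (max (t - r) 0) = ∫ s, f1 s • g1 (t - r - s) :=
    (measurePreserving_sub_right volume r).quasiMeasurePreserving.ae hrep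
  have hii : ∀ t < T, Integrable (fun s => f1 s • g1 (t - s)) := by
    intro t ht
    have e : (fun s => f1 s • g1 (t - s))
        = fun s => (Ioo 0 T).indicator (fun s : ℝ => s ^ (α - 1) / Real.Gamma α) s • g1 (t - s) := by
      ext s
      by_cases h0 : 0 < s
      · by_cases h1 : s < T
        · rw [hf1, indicator_of_mem (show s ∈ Ioi 0 from h0), indicator_of_mem (show s ∈ Ioo 0 T from ⟨h0, h1⟩)]
        · rw [hg1, indicator_of_notMem (fun h => by linarith [h.1])]; simp
      · rw [hf1, indicator_of_notMem (show s ∉ Ioi 0 from fun h => h0 h), indicator_of_notMem (fun h => h0 h.1)]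
    rw [e]
    exact (air_int_pow (p := α - 1) (by linarith) hT).smul_bdd C
      (ig.aestronglyMeasurable.comp_quasiMeasurePreserving (quasiMeasurePreserving_sub_left volume t))
      (Filter.Eventually.of_forall fun s => hC _)
  have hW : ∀ᵐ t, t ∈ Ioo 0 T → u (max t 0) - u (max (t - r) 0) = ∫ s, k s • g1 (t - s) := by
    filter_upwards [hrep, hrep'] with t h1 h2 ht
    rw [h1 ht.2, h2 (by linarith [ht.2])]
    have i2 := (hii (t - r) (by linarith [ht.2])).comp_sub_right r
    rw [← integral_sub_right_eq_self (fun s => f1 s • g1 (t - r - s)) r,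
      ← integral_sub (hii t ht.2) i2]
    congr 1; ext s
    rw [show t - r - (s - r) = t - s by ring, ← sub_smul]
    by_cases hs : s < T + r
    · rw [hkeq s hs]
    · rw [hg1, indicator_of_notMem (fun h => by linarith [h.1, ht.2])]; simp
  refine (air_young ik ig hC hT hW).trans ?_
  have e : ∫ t, ‖g1 t‖ ^ 2 = ∫ t in (0:ℝ)..T, ‖fracInt (1 - α) u' t‖ ^ 2 := by
    rw [intervalIntegral.integral_of_le hT.le, integral_Ioc_eq_integral_Ioo,
      ← integral_indicator measurableSet_Ioo]
    congr 1; ext t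
    by_cases ht : t ∈ Ioo 0 T
    · rw [hg1, indicator_of_mem ht, indicator_of_mem ht]
    · rw [hg1, indicator_of_notMem ht, indicator_of_notMem ht]; simp
  rw [e]
  have : 0 ≤ ∫ s, ‖k s‖ := integral_nonneg fun s => norm_nonneg _
  have : 0 ≤ ∫ t in (0:ℝ)..T, ‖fracInt (1 - α) u' t‖ ^ 2 :=
    intervalIntegral.integral_nonneg hT.le fun t _ => by positivity
  gcongr

lemma air_cs {Y : Type*} [NormedAddCommGroup Y] [NormedSpace ℝ Y] {q : ℝ → Y} (hq : Continuous q)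
    {h : ℝ} (hh : 0 < h) : ‖∫ r in (0:ℝ)..h, q r‖ ^ 2 ≤ h * ∫ r in (0:ℝ)..h, ‖q r‖ ^ 2 := by
  set c := ∫ r in (0:ℝ)..h, ‖q r‖
  set P := ∫ r in (0:ℝ)..h, ‖q r‖ ^ 2
  have h1 : ‖∫ r in (0:ℝ)..h, q r‖ ≤ c := intervalIntegral.norm_integral_le_integral_norm hh.le
  have h2 : 0 ≤ ∫ r in (0:ℝ)..h, (‖q r‖ - c / h) ^ 2 :=
    intervalIntegral.integral_nonneg hh.le fun t _ => by positivity
  have e : ∀ r, (‖q r‖ - c / h) ^ 2 = ‖q r‖ ^ 2 + ((-2 * (c / h)) * ‖q r‖ + (c / h) ^ 2) :=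
    fun r => by ring
  simp_rw [e] at h2
  rw [intervalIntegral.integral_add (Continuous.intervalIntegrable (by fun_prop) _ _)
      (Continuous.intervalIntegrable (by fun_prop) _ _),
    intervalIntegral.integral_add (Continuous.intervalIntegrable (by fun_prop) _ _)
      (Continuous.intervalIntegrable (by fun_prop) _ _),
    intervalIntegral.integral_const_mul, intervalIntegral.integral_const] at h2
  have e2 : P + (-2 * (c / h) * c + (h - 0) • (c / h) ^ 2) = (h * P - c ^ 2) / h := by
    simp only [smul_eq_mul]; field_simp; ring
  rw [e2] at h2
  have h3 : 0 ≤ h * P - c ^ 2 := by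
    by_contra hn
    push Not at hn
    exact absurd (div_neg_of_neg_of_pos hn hh) (not_lt.2 h2)
  calc _ ≤ c ^ 2 := by gcongr
    _ ≤ _ := by linarith

/-- α-robust interpolation estimate: if a linear map `B` on functions satisfies
`‖Bu‖ ≤ M₀ ‖u‖_{L²(0,T;Y)}` and `‖Bu‖ ≤ M₁ ‖u'‖_{L²(0,T;Y)}` for `u(0) = 0`, then
`‖Bu‖ ≤ e^{1+(π/4)²} M₀^{1-α} M₁^α ‖D₀^α u‖_{L²(0,T;Y)}` where `D₀^α u = I^{1-α} u'`. -/
theorem alpha_robust_interpolation {Y Z : Type*}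
    [NormedAddCommGroup Y] [InnerProductSpace ℂ Y] [CompleteSpace Y]
    [NormedAddCommGroup Z] [InnerProductSpace ℂ Z] [CompleteSpace Z]
    (T α M₀ M₁ : ℝ) (hT : 0 < T) (hα : 0 < α) (hα1 : α < 1)
    (hM₀ : 0 < M₀) (hM₁ : 0 < M₁)
    (B : (ℝ → Y) →ₗ[ℂ] Z)
    (hB0 : ∀ u : ℝ → Y, Continuous u →
      ‖B u‖ ≤ M₀ * Real.sqrt (∫ t in (0:ℝ)..T, ‖u t‖ ^ 2))
    (hB1 : ∀ u u' : ℝ → Y, (∀ t, HasDerivAt u (u' t) t) → Continuous u' → u 0 = 0 →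
      ‖B u‖ ≤ M₁ * Real.sqrt (∫ t in (0:ℝ)..T, ‖u' t‖ ^ 2))
    (u u' : ℝ → Y) (hu : ∀ t, HasDerivAt u (u' t) t) (hu' : Continuous u')
    (hu0 : u 0 = 0) :
    ‖B u‖ ≤ Real.exp (1 + (π / 4) ^ 2) * M₀ ^ (1 - α) * M₁ ^ α
        * Real.sqrt (∫ t in (0:ℝ)..T, ‖fracInt (1 - α) u' t‖ ^ 2) := by
  set N := ∫ t in (0:ℝ)..T, ‖fracInt (1 - α) u' t‖ ^ 2 with hN
  have hN0 : 0 ≤ N := intervalIntegral.integral_nonneg hT.le fun t _ => by positivity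
  have hΓ := air_gamma hα hα1
  have hΓ0 : 0 < Real.Gamma (α + 1) := by linarith
  set K := 2 / Real.Gamma (α + 1) with hK
  have hK0 : 0 ≤ K := by positivity
  have hK1 : K ≤ 2.5 := by
    rw [hK, div_le_iff₀ hΓ0]; linarith
  set h := M₁ / M₀ with hh
  have hpos : 0 < h := div_pos hM₁ hM₀
  have huc : Continuous u := continuous_iff_continuousAt.2 fun t => (hu t).continuousAt
  set v : ℝ → Y := fun t => u (max t 0) with hv
  have hvc : Continuous v := by fun_prop
  have hdiff : ∀ r, 0 < r → ∫ t in (0:ℝ)..T, ‖v t - v (t - r)‖ ^ 2 ≤ (K * r ^ α) ^ 2 * N := by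
    intro r hr
    have := air_diff hT hα hα1 hr u u' hu hu' hu0
    rwa [show 2 * r ^ α / Real.Gamma (α + 1) = K * r ^ α by rw [hK]; ring] at this
  set V : ℝ → Y := fun t => h⁻¹ • ((∫ s in (0:ℝ)..t, v s) - ∫ s in (0:ℝ)..(t - h), v s) with hV
  set V' : ℝ → Y := fun t => h⁻¹ • (v t - v (t - h)) with hV'
  have hVd : ∀ t, HasDerivAt V (V' t) t := by
    intro t
    have d1 : ∀ t, HasDerivAt (fun t => ∫ s in (0:ℝ)..t, v s) (v t) t := fun t =>
      intervalIntegral.integral_hasDerivAt_right (hvc.intervalIntegrable _ _)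
        (hvc.stronglyMeasurableAtFilter _ _) hvc.continuousAt
    exact ((d1 t).sub ((d1 (t - h)).comp_sub_const t h)).const_smul h⁻¹
  have hV'c : Continuous V' := by fun_prop
  have hVc : Continuous V := continuous_iff_continuousAt.2 fun t => (hVd t).continuousAt
  have hvneg : ∀ t ≤ 0, v t = 0 := fun t ht => by simp [hv, max_eq_right ht, hu0]
  have hV0 : V 0 = 0 := by
    have : ∫ s in (0:ℝ)..(0 - h), v s = 0 := by
      rw [intervalIntegral.integral_congr (g := fun _ => (0:Y))]
      · simp
      · intro s hs
        rw [uIcc_of_ge (by linarith)] at hs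
        exact hvneg s hs.2
    simp only [hV]
    rw [this]; simp
  have b1 : ‖B V‖ ≤ M₁ * (h⁻¹ * (K * h ^ α) * √N) := by
    refine (hB1 V V' hVd hV'c hV0).trans ?_
    gcongr
    rw [Real.sqrt_le_iff]
    refine ⟨by positivity, ?_⟩
    have : ∀ t, ‖V' t‖ ^ 2 = (h⁻¹) ^ 2 * ‖v t - v (t - h)‖ ^ 2 := fun t => by
      rw [hV', norm_smul, mul_pow, Real.norm_of_nonneg (inv_nonneg.2 hpos.le)]
    simp_rw [this]
    rw [intervalIntegral.integral_const_mul, mul_pow, mul_pow, Real.sq_sqrt hN0, mul_assoc]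
    gcongr
    exact hdiff h hpos
  have hWeq : ∀ t ∈ Icc 0 T, u t - V t = h⁻¹ • ∫ r in (0:ℝ)..h, (v t - v (t - r)) := by
    intro t ht
    rw [intervalIntegral.integral_sub (by simp) (Continuous.intervalIntegrable (by fun_prop) _ _),
      intervalIntegral.integral_const, intervalIntegral.integral_comp_sub_left (fun s => v s),
      smul_sub, smul_smul, sub_zero, sub_zero, inv_mul_cancel₀ hpos.ne', one_smul]
    have : v t = u t := by simp [hv, max_eq_left ht.1]
    rw [this, hV]
    simp only
    rw [intervalIntegral.integral_interval_sub_left (hvc.intervalIntegrable _ _) (hvc.intervalIntegrable _ _)]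
  have b2 : ‖B (u - V)‖ ≤ M₀ * ((K * h ^ α) * √N) := by
    refine (hB0 (u - V) (huc.sub hVc)).trans ?_
    gcongr
    rw [Real.sqrt_le_iff]
    refine ⟨by positivity, ?_⟩
    rw [mul_pow, Real.sq_sqrt hN0]
    set F : ℝ → ℝ → ℝ := fun t r => ‖v t - v (t - r)‖ ^ 2 with hF
    have hFc : Continuous (Function.uncurry F) := by
      simp only [hF, Function.uncurry_def]; fun_prop
    calc ∫ t in (0:ℝ)..T, ‖(u - V) t‖ ^ 2
        ≤ ∫ t in (0:ℝ)..T, h⁻¹ * ∫ r in (0:ℝ)..h, F t r := by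
          apply intervalIntegral.integral_mono_on hT.le
          · exact Continuous.intervalIntegrable (by fun_prop) _ _
          · refine Continuous.intervalIntegrable (continuous_const.mul ?_) _ _
            exact intervalIntegral.continuous_parametric_intervalIntegral_of_continuous' hFc 0 h
          · intro t ht
            rw [Pi.sub_apply, hWeq t ht, norm_smul, mul_pow, Real.norm_of_nonneg (inv_nonneg.2 hpos.le)]
            have := air_cs (q := fun r => v t - v (t - r)) (by fun_prop) hpos
            calc _ ≤ h⁻¹ ^ 2 * (h * ∫ r in (0:ℝ)..h, F t r) := by gcongr
              _ = _ := by field_simp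
      _ = h⁻¹ * ∫ r in (0:ℝ)..h, ∫ t in (0:ℝ)..T, F t r := by
          rw [intervalIntegral.integral_const_mul, intervalIntegral_intervalIntegral_swap]
          refine IntegrableOn.mono_set ?_ (prod_mono uIoc_subset_uIcc uIoc_subset_uIcc)
          exact hFc.continuousOn.integrableOn_compact (isCompact_uIcc.prod isCompact_uIcc)
      _ ≤ h⁻¹ * ∫ r in (0:ℝ)..h, (K * h ^ α) ^ 2 * N := by
          gcongr
          apply intervalIntegral.integral_mono_on_of_le_Ioo hpos.le
          · refine Continuous.intervalIntegrable ?_ _ _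
            exact intervalIntegral.continuous_parametric_intervalIntegral_of_continuous'
              (f := fun r t => F t r) (hFc.comp continuous_swap) 0 T
          · simp
          · intro r hr
            refine (hdiff r hr.1).trans ?_
            have := hr.1.le
            have := hr.2.le
            gcongr
      _ = _ := by
          rw [intervalIntegral.integral_const, smul_eq_mul, sub_zero]; field_simp
  have hsum : B u = B (u - V) + B V := by rw [← map_add, sub_add_cancel]
  have hA : M₀ * h ^ α = M₀ ^ (1 - α) * M₁ ^ α := by
    rw [hh, Real.div_rpow hM₁.le hM₀.le, Real.rpow_sub hM₀, Real.rpow_one]; ring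
  have hA' : M₁ * h⁻¹ = M₀ := by rw [hh]; field_simp
  calc ‖B u‖ ≤ M₀ * ((K * h ^ α) * √N) + M₁ * (h⁻¹ * (K * h ^ α) * √N) := by
        rw [hsum]; exact (norm_add_le _ _).trans (add_le_add b2 b1)
    _ = (2 * K) * (M₀ * h ^ α) * √N + (M₁ * h⁻¹ - M₀) * (K * h ^ α * √N) := by ring
    _ = (2 * K) * (M₀ ^ (1 - α) * M₁ ^ α) * √N := by rw [hA', hA]; ring
    _ ≤ Real.exp (1 + (π / 4) ^ 2) * (M₀ ^ (1 - α) * M₁ ^ α) * √N := by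
        gcongr
        linarith [air_exp]
    _ = _ := by ring
end
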